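/- If P is an r-differential poset and Q is an s-differential poset, then the Cartesian product P × Q, ordered componentwise, is an (r+s)-differential poset. -/

import Mathlib

open Polynomial

/-- A rectangular matrix over a commutative ring has Smith normal form: there are
invertible matrices `P`, `Q` such that `P * A * Q` is diagonal with diagonal entries
forming a divisibility chain. -/
def Matrix.HasSNF {R : Type*} [CommRing R] {m n : ℕ} (A : Matrix (Fin m) (Fin n) R) : Prop :=
  ∃ (P : Matrix (Fin m) (Fin m) R) (Q : Matrix (Fin n) (Fin n) R),
    IsUnit P ∧ IsUnit Q ∧
    (∀ (i : Fin m) (j : Fin n), (i : ℕ) ≠ (j : ℕ) → (P * A * Q) i j = 0) ∧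
    (∀ (i : ℕ) (h₁ : i + 1 < m) (h₂ : i + 1 < n),
      (P * A * Q) ⟨i, Nat.lt_of_succ_lt h₁⟩ ⟨i, Nat.lt_of_succ_lt h₂⟩ ∣
        (P * A * Q) ⟨i + 1, h₁⟩ ⟨i + 1, h₂⟩)

/-- SNF for matrices with arbitrary finite index types. -/
def Matrix.HasSNF' {ι κ R : Type*} [Fintype ι] [Fintype κ] [CommRing R]
    (A : Matrix ι κ R) : Prop :=
  ∃ (eι : ι ≃ Fin (Fintype.card ι)) (eκ : κ ≃ Fin (Fintype.card κ)),
    Matrix.HasSNF (Matrix.reindex eι eκ A)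
/-- An endomorphism `φ` of a `ℤ`-module `M` (equivalently, the `ℤ[x]`-module `(M, φ)` where
`x` acts as `φ`) has rational canonical form over `ℤ`: `M` is an internal direct sum of
cyclic `ℤ[x]`-submodules whose annihilators are generated by monic non-constant polynomials
`a_1 ∣ a_2 ∣ ... ∣ a_k`. -/
def Module.End.HasRCF {M : Type*} [AddCommGroup M] [Module ℤ M] (φ : Module.End ℤ M) : Prop :=
  ∃ (k : ℕ) (V : Fin k → Submodule ℤ[X] (Module.AEval' φ)) (a : Fin k → ℤ[X]),
    (∀ i, (a i).Monic) ∧ (∀ i, 0 < (a i).natDegree) ∧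
    (∀ i j : Fin k, i ≤ j → a i ∣ a j) ∧
    (∀ i, ∃ v : Module.AEval' φ, V i = Submodule.span ℤ[X] {v}) ∧
    (∀ i, (V i).annihilator = Ideal.span {a i}) ∧
    DirectSum.IsInternal V
/-- An `r`-differential poset. -/
structure DiffPoset (r : ℕ) where
  P : Type
  [po : PartialOrder P]
  locallyFinite : ∀ x y : P, (Set.Icc x y).Finite
  rk : P → ℕ
  fiberFinite : ∀ n : ℕ, {x : P | rk x = n}.Finite
  bot : P
  bot_le : ∀ x : P, bot ≤ x
  rk_bot : rk bot = 0
  rk_covBy : ∀ {x y : P}, x ⋖ y → rk y = rk x + 1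
  d2 : ∀ {x y : P}, x ≠ y →
      {z : P | z ⋖ x ∧ z ⋖ y}.ncard = {z : P | x ⋖ z ∧ y ⋖ z}.ncard
  d3 : ∀ x : P, {z : P | x ⋖ z}.ncard = {z : P | z ⋖ x}.ncard + r

attribute [instance] DiffPoset.po

namespace DiffPoset

variable {r : ℕ} (D : DiffPoset r)

/-- The `n`-th rank `P_n` of the poset. -/
abbrev level (n : ℕ) : Type := {x : D.P // D.rk x = n}

noncomputable instance (n : ℕ) : Fintype (D.level n) := (D.fiberFinite n).fintype

noncomputable instance (n : ℕ) : DecidableEq (D.level n) := Classical.decEq _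

noncomputable instance (x y : D.P) : Decidable (x ⋖ y) := Classical.dec _

/-- The rank size `p_n`. -/
noncomputable def p (n : ℕ) : ℕ := Fintype.card (D.level n)

/-- The matrix of the up map `U_n` in the standard basis. -/
noncomputable def upMatrix (R : Type*) [CommRing R] (n : ℕ) :
    Matrix (D.level (n + 1)) (D.level n) R :=
  fun y x => if (x : D.P) ⋖ (y : D.P) then 1 else 0

/-- The matrix of the down map `D_{n+1}` in the standard basis. -/
noncomputable def downMatrix (R : Type*) [CommRing R] (n : ℕ) :
    Matrix (D.level n) (D.level (n + 1)) R :=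
  fun y x => if (y : D.P) ⋖ (x : D.P) then 1 else 0

/-- The up map `U_n : RP_n → RP_{n+1}`. -/
noncomputable def up (R : Type*) [CommRing R] (n : ℕ) :
    (D.level n → R) →ₗ[R] (D.level (n + 1) → R) :=
  (D.upMatrix R n).mulVecLin

/-- The down map `D_{n+1} : RP_{n+1} → RP_n`. -/
noncomputable def down (R : Type*) [CommRing R] (n : ℕ) :
    (D.level (n + 1) → R) →ₗ[R] (D.level n → R) :=
  (D.downMatrix R n).mulVecLin

/-- The operator `DU_n = D_{n+1} ∘ U_n`. -/
noncomputable def du (R : Type*) [CommRing R] (n : ℕ) :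
    Module.End R (D.level n → R) :=
  (D.down R n) ∘ₗ (D.up R n)

/-- The matrix `[DU_n]` in the standard basis. -/
noncomputable def duMatrix (R : Type*) [CommRing R] (n : ℕ) :
    Matrix (D.level n) (D.level n) R :=
  D.downMatrix R n * D.upMatrix R n

/-- The operator `UD_n = U_{n-1} ∘ D_n` (zero for `n = 0`). -/
noncomputable def ud (R : Type*) [CommRing R] : (n : ℕ) → Module.End R (D.level n → R)
  | 0 => 0
  | (n + 1) => (D.up R n) ∘ₗ (D.down R n)

/-- The matrix `[UD_n]` in the standard basis (zero for `n = 0`). -/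
noncomputable def udMatrix (R : Type*) [CommRing R] :
    (n : ℕ) → Matrix (D.level n) (D.level n) R
  | 0 => 0
  | (n + 1) => D.upMatrix R n * D.downMatrix R n

/-- The rank size difference `Δp_n = p_n - p_{n-1}` (with `p_{-1} = 0`), as an integer. -/
noncomputable def dp : ℕ → ℤ
  | 0 => (D.p 0 : ℤ)
  | (n + 1) => (D.p (n + 1) : ℤ) - (D.p n : ℤ)

/-- The rank size difference `Δp_n = p_n - p_{n-1}` (with `p_{-1} = 0`), as a natural number. -/
noncomputable def dpN : ℕ → ℕ
  | 0 => D.p 0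
  | (n + 1) => D.p (n + 1) - D.p n

end DiffPoset

namespace Prod

/-- The size of a cross-shaped subset of a product, when one arm avoids the centre `(a, b)`. -/
theorem ncard_image_union_image {α β : Type*} {a : α} {b : β} {s : Set α} {t : Set β}
    (hs : s.Finite) (ht : t.Finite) (ha : a ∉ s) :
    ((fun c => (c, b)) '' s ∪ (fun d => (a, d)) '' t).ncard = s.ncard + t.ncard := by
  rw [Set.ncard_union_eq _ (hs.image _) (ht.image _),
    Set.ncard_image_of_injective _ (Prod.mk_left_injective b),
    Set.ncard_image_of_injective _ (Prod.mk_right_injective a)]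
  rw [Set.disjoint_left]
  rintro _ ⟨c, hc, rfl⟩ ⟨d, -, h⟩
  exact ha ((Prod.mk.inj h).1 ▸ hc)

variable {α β : Type*} [PartialOrder α] [PartialOrder β]

theorem setOf_covBy_eq (x : α × β) :
    {z : α × β | x ⋖ z} =
      (fun c => (c, x.2)) '' {c | x.1 ⋖ c} ∪ (fun d => (x.1, d)) '' {d | x.2 ⋖ d} := by
  obtain ⟨a, b⟩ := x
  ext ⟨c, d⟩
  simp only [Set.mem_ofPred_eq, mk_covBy_mk_iff, Set.mem_union, Set.mem_image, Prod.mk.injEq]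
  grind

theorem setOf_covBy_right_eq (x : α × β) :
    {z : α × β | z ⋖ x} =
      (fun c => (c, x.2)) '' {c | c ⋖ x.1} ∪ (fun d => (x.1, d)) '' {d | d ⋖ x.2} := by
  obtain ⟨a, b⟩ := x
  ext ⟨c, d⟩
  simp only [Set.mem_ofPred_eq, mk_covBy_mk_iff, Set.mem_union, Set.mem_image, Prod.mk.injEq]
  grind

theorem ncard_setOf_covBy {x : α × β} (h₁ : {c | x.1 ⋖ c}.Finite) (h₂ : {d | x.2 ⋖ d}.Finite) :
    {z | x ⋖ z}.ncard = {c | x.1 ⋖ c}.ncard + {d | x.2 ⋖ d}.ncard := by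
  rw [setOf_covBy_eq, ncard_image_union_image h₁ h₂ fun h => h.ne rfl]

theorem ncard_setOf_covBy_right {x : α × β} (h₁ : {c | c ⋖ x.1}.Finite)
    (h₂ : {d | d ⋖ x.2}.Finite) :
    {z | z ⋖ x}.ncard = {c | c ⋖ x.1}.ncard + {d | d ⋖ x.2}.ncard := by
  rw [setOf_covBy_right_eq, ncard_image_union_image h₁ h₂ fun h => h.ne rfl]

theorem setOf_common_lower_cover_eq_of_ne {a a' : α} {b b' : β} (ha : a ≠ a') (hb : b ≠ b') :
    {z | z ⋖ (a, b) ∧ z ⋖ (a', b')} =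
      {z | z = (a', b) ∧ a' ⋖ a ∧ b ⋖ b' ∨ z = (a, b') ∧ a ⋖ a' ∧ b' ⋖ b} := by
  ext ⟨c, d⟩
  simp only [Set.mem_ofPred_eq, mk_covBy_mk_iff, Prod.mk.injEq]
  grind

theorem setOf_common_upper_cover_eq_of_ne {a a' : α} {b b' : β} (ha : a ≠ a') (hb : b ≠ b') :
    {z | (a, b) ⋖ z ∧ (a', b') ⋖ z} =
      {z | z = (a, b') ∧ a' ⋖ a ∧ b ⋖ b' ∨ z = (a', b) ∧ a ⋖ a' ∧ b' ⋖ b} := by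
  ext ⟨c, d⟩
  simp only [Set.mem_ofPred_eq, mk_covBy_mk_iff, Prod.mk.injEq]
  grind

theorem ncard_common_covers_eq_of_ne {a a' : α} {b b' : β} (ha : a ≠ a') (hb : b ≠ b') :
    {z | z ⋖ (a, b) ∧ z ⋖ (a', b')}.ncard = {z | (a, b) ⋖ z ∧ (a', b') ⋖ z}.ncard := by
  rw [setOf_common_lower_cover_eq_of_ne ha hb, setOf_common_upper_cover_eq_of_ne ha hb]
  by_cases h : a' ⋖ a ∧ b ⋖ b'
  · have h' : ¬ (a ⋖ a' ∧ b' ⋖ b) := fun k => h.1.lt.asymm k.1.lt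
    simp [h, h']
  · by_cases h' : a ⋖ a' ∧ b' ⋖ b <;> simp [h, h']

theorem ncard_common_covers_left {a a' : α} (b : β) (ha : a ≠ a') :
    {z | z ⋖ (a, b) ∧ z ⋖ (a', b)}.ncard = {c | c ⋖ a ∧ c ⋖ a'}.ncard ∧
      {z | (a, b) ⋖ z ∧ (a', b) ⋖ z}.ncard = {c | a ⋖ c ∧ a' ⋖ c}.ncard := by
  have hb : ¬ b ⋖ b := fun h => h.ne rfl
  constructor <;>
    refine .trans (congrArg Set.ncard ?_)
      (Set.ncard_image_of_injective _ (Prod.mk_left_injective b)) <;>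
    ext ⟨c, d⟩ <;>
    simp only [Set.mem_ofPred_eq, mk_covBy_mk_iff, Set.mem_image, Prod.mk.injEq] <;> grind

theorem ncard_common_covers_right (a : α) {b b' : β} (hb : b ≠ b') :
    {z | z ⋖ (a, b) ∧ z ⋖ (a, b')}.ncard = {d | d ⋖ b ∧ d ⋖ b'}.ncard ∧
      {z | (a, b) ⋖ z ∧ (a, b') ⋖ z}.ncard = {d | b ⋖ d ∧ b' ⋖ d}.ncard := by
  have ha : ¬ a ⋖ a := fun h => h.ne rfl
  constructor <;>
    refine .trans (congrArg Set.ncard ?_)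
      (Set.ncard_image_of_injective _ (Prod.mk_right_injective a)) <;>
    ext ⟨c, d⟩ <;>
    simp only [Set.mem_ofPred_eq, mk_covBy_mk_iff, Set.mem_image, Prod.mk.injEq] <;> grind

end Prod

namespace DiffPoset

variable {r : ℕ} (D : DiffPoset r)

theorem finite_setOf_covBy (x : D.P) : {z | x ⋖ z}.Finite :=
  (D.fiberFinite (D.rk x + 1)).subset fun _ h => D.rk_covBy h

theorem finite_setOf_covBy_right (x : D.P) : {z | z ⋖ x}.Finite :=
  (D.locallyFinite D.bot x).subset fun _ h => ⟨D.bot_le _, h.le⟩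

end DiffPoset

/-- The Cartesian product of an `r`-differential poset and an
`s`-differential poset, ordered componentwise and graded by the sum of the ranks, is an
`(r+s)`-differential poset. -/
theorem prod_is_differential {r s : ℕ} (hr : 0 < r) (hs : 0 < s)
    (D : DiffPoset r) (E : DiffPoset s) :
    (∀ x y : D.P × E.P, (Set.Icc x y).Finite) ∧
    (∀ n : ℕ, {x : D.P × E.P | D.rk x.1 + E.rk x.2 = n}.Finite) ∧
    (∀ x : D.P × E.P, (D.bot, E.bot) ≤ x) ∧
    (D.rk D.bot + E.rk E.bot = 0) ∧
    (∀ x y : D.P × E.P, x ⋖ y → D.rk y.1 + E.rk y.2 = D.rk x.1 + E.rk x.2 + 1) ∧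
    (∀ x y : D.P × E.P, x ≠ y →
      {z : D.P × E.P | z ⋖ x ∧ z ⋖ y}.ncard = {z : D.P × E.P | x ⋖ z ∧ y ⋖ z}.ncard) ∧
    (∀ x : D.P × E.P, {z : D.P × E.P | x ⋖ z}.ncard = {z : D.P × E.P | z ⋖ x}.ncard + (r + s)) := by
  refine ⟨fun x y => ?_, fun n => ?_, fun x => ⟨D.bot_le _, E.bot_le _⟩,
    by rw [D.rk_bot, E.rk_bot], ?_, ?_, fun x => ?_⟩
  · rw [Set.Icc_prod_eq]
    exact (D.locallyFinite _ _).prod (E.locallyFinite _ _)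
  · refine ((Finset.HasAntidiagonal.antidiagonal n).finite_toSet.biUnion fun p _ =>
      (D.fiberFinite p.1).prod (E.fiberFinite p.2)).subset fun x hx => ?_
    exact Set.mem_biUnion (x := (D.rk x.1, E.rk x.2))
      (Finset.mem_coe.2 (Finset.HasAntidiagonal.mem_antidiagonal.2 hx)) ⟨rfl, rfl⟩
  · rintro ⟨a, b⟩ ⟨a', b'⟩ h
    rcases Prod.mk_covBy_mk_iff.1 h with ⟨hc, rfl⟩ | ⟨hc, rfl⟩
    · simp only [D.rk_covBy hc]
      omega
    · simp only [E.rk_covBy hc]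
      omega
  · rintro ⟨a, b⟩ ⟨a', b'⟩ h
    by_cases ha : a = a'
    · subst ha
      have hb : b ≠ b' := fun hb => h (hb ▸ rfl)
      rw [(Prod.ncard_common_covers_right a hb).1, (Prod.ncard_common_covers_right a hb).2, E.d2 hb]
    by_cases hb : b = b'
    · subst hb
      rw [(Prod.ncard_common_covers_left b ha).1, (Prod.ncard_common_covers_left b ha).2, D.d2 ha]
    exact Prod.ncard_common_covers_eq_of_ne ha hb
  · rw [Prod.ncard_setOf_covBy (D.finite_setOf_covBy _) (E.finite_setOf_covBy _),
      Prod.ncard_setOf_covBy_right (D.finite_setOf_covBy_right _) (E.finite_setOf_covBy_right _),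
      D.d3, E.d3]
    omega
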